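/- arXiv:2509.14411 — 11 statements merged into one kernel-verified Lean document; each statement's English description precedes it below -/
import Mathlib

section
/- Let λ, κ > 0 be real numbers such that for every real number c and for each p ∈ {1, 2} the inequality c/p ≤ λ·e^c − κ holds. Then λ/κ ≥ 2/(e·ln 2). Moreover, the pair λ = 2/e, κ = ln 2 satisfies all these constraints and achieves λ/κ = 2/(e·ln 2); hence the minimum value of λ/κ over all λ, κ > 0 satisfying the constraints is exactly 2/(e·ln 2). -/
/-- If `λ, κ > 0` satisfy `c/p ≤ λ·e^c − κ` for all real `c` and `p ∈ {1,2}`,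
then `λ/κ ≥ 2/(e·ln 2)`; moreover `λ = 2/e`, `κ = ln 2` satisfies the constraints and
achieves `λ/κ = 2/(e·ln 2)`, so the minimum is exactly `2/(e·ln 2)`. -/
theorem stmt_0 :
    (∀ lam kappa : ℝ, 0 < lam → 0 < kappa →
        (∀ c : ℝ, c / 1 ≤ lam * Real.exp c - kappa) →
        (∀ c : ℝ, c / 2 ≤ lam * Real.exp c - kappa) →
        2 / (Real.exp 1 * Real.log 2) ≤ lam / kappa) ∧
    (0 < (2 / Real.exp 1 : ℝ) ∧ 0 < Real.log 2 ∧
      (∀ c : ℝ, c / 1 ≤ (2 / Real.exp 1) * Real.exp c - Real.log 2) ∧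
      (∀ c : ℝ, c / 2 ≤ (2 / Real.exp 1) * Real.exp c - Real.log 2) ∧
      (2 / Real.exp 1) / Real.log 2 = 2 / (Real.exp 1 * Real.log 2)) := by
  have hl1 : Real.log 2 < 1 := by linarith [Real.log_two_lt_d9]
  have hl2 : 1 / 2 < Real.log 2 := by linarith [Real.log_two_gt_d9]
  have he : 0 < Real.exp 1 := Real.exp_pos 1
  refine ⟨fun lam kappa hlam hkappa h1 h2 => ?_, by positivity, by linarith,
    fun c => ?_, fun c => ?_, by rw [div_div]⟩
  · have k1 := h1 (-Real.log lam)
    have k2 := h2 (-Real.log (2 * lam))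
    rw [Real.exp_neg, Real.exp_log hlam, mul_inv_cancel₀ hlam.ne'] at k1
    have e2 : lam * (2 * lam)⁻¹ = 1 / 2 := by field_simp
    rw [Real.exp_neg, Real.exp_log (by positivity), e2,
      Real.log_mul two_ne_zero hlam.ne'] at k2
    have hmu : Real.log (lam * Real.exp 1 / 2) = Real.log lam + 1 - Real.log 2 := by
      rw [Real.log_div (by positivity) two_ne_zero, Real.log_mul hlam.ne' he.ne', Real.log_exp]
    have hb := Real.log_le_sub_one_of_pos (show 0 < lam * Real.exp 1 / 2 by positivity)
    rw [hmu] at hb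
    have key : kappa ≤ lam * Real.exp 1 / 2 * Real.log 2 := by
      rcases le_total (lam * Real.exp 1 / 2) 1 with h | h
      · nlinarith [mul_nonneg (sub_nonneg.2 h) (sub_nonneg.2 hl1.le)]
      · nlinarith [mul_nonneg (sub_nonneg.2 h) (sub_nonneg.2 hl2.le)]
    rw [div_le_div_iff₀ (by positivity) hkappa]
    linarith
  · have h := Real.add_one_le_exp (c - 1 + Real.log 2)
    rw [Real.exp_add, Real.exp_sub, Real.exp_log two_pos] at h
    have e : 2 / Real.exp 1 * Real.exp c = Real.exp c / Real.exp 1 * 2 := by ring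
    linarith
  · have h := Real.add_one_le_exp (c - 1 + Real.log 2 + Real.log 2)
    rw [Real.exp_add, Real.exp_add, Real.exp_sub, Real.exp_log two_pos] at h
    have e : 2 / Real.exp 1 * Real.exp c = Real.exp c / Real.exp 1 * 2 := by ring
    linarith
end

section
/- Define ζ(α) = ((α − 1)^(α−1) / α^α) · ((2^(α/(α−1)) − 1)^α / (2^(α/(α−1)) − 2)) for real α > 1. Then the limit of ζ(α) as α → ∞ equals 2/(e·ln 2). -/
open Filter

/-- The worst-case price-of-anarchy bound `ζ(α)` for cost functions `‖z‖^α`. -/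
noncomputable def zeta (α : ℝ) : ℝ :=
  ((α - 1) ^ (α - 1) / α ^ α) *
    (((2 : ℝ) ^ (α / (α - 1)) - 1) ^ α / ((2 : ℝ) ^ (α / (α - 1)) - 2))

lemma tendsto_mul_rpow_inv_sub_one_atTop {a : ℝ} (ha : 0 < a) :
    Tendsto (fun t : ℝ => t * (a ^ t⁻¹ - 1)) atTop (nhds (Real.log a)) := by
  have hderiv : HasDerivAt (fun x : ℝ => a ^ x) (Real.log a) 0 := by
    simpa using (Real.hasStrictDerivAt_const_rpow ha 0).hasDerivAt
  have hinv : Tendsto (fun t : ℝ => t⁻¹) atTop (nhdsWithin 0 {0}ᶜ) :=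
    tendsto_inv_atTop_nhdsGT_zero.mono_right (nhdsWithin_mono _ fun x hx => ne_of_gt hx)
  simpa [Function.comp_def] using hderiv.tendsto_slope_zero.comp hinv

lemma zeta_add_one {t : ℝ} (ht : 0 < t) :
    zeta (t + 1) = ((1 + 1 / t) ^ t)⁻¹ * (1 + 2 * ((2 : ℝ) ^ t⁻¹ - 1)) ^ t *
      (1 + 2 * ((2 : ℝ) ^ t⁻¹ - 1)) /
        (2 * (t * ((2 : ℝ) ^ t⁻¹ - 1)) + 2 * ((2 : ℝ) ^ t⁻¹ - 1)) := by
  have hexp : (2 : ℝ) ^ ((t + 1) / t) = 2 * 2 ^ t⁻¹ := by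
    rw [add_div, div_self ht.ne', one_div, Real.rpow_add two_pos, Real.rpow_one]
  have hgt : 1 < (2 : ℝ) ^ t⁻¹ := Real.one_lt_rpow one_lt_two (inv_pos.2 ht)
  have hbase : 1 + 1 / t = (t + 1) / t := by field_simp
  rw [zeta, add_sub_cancel_right, hexp, hbase, Real.div_rpow (by positivity) ht.le]
  rw [show 2 * (2 : ℝ) ^ t⁻¹ - 1 = 1 + 2 * ((2 : ℝ) ^ t⁻¹ - 1) by ring,
    show 2 * (2 : ℝ) ^ t⁻¹ - 2 = 2 * ((2 : ℝ) ^ t⁻¹ - 1) by ring]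
  have hu : 0 < (2 : ℝ) ^ t⁻¹ - 1 := sub_pos.2 hgt
  generalize (2 : ℝ) ^ t⁻¹ - 1 = u at hu ⊢
  rw [Real.rpow_add_one (by positivity), Real.rpow_add_one (by positivity),
    show 2 * (t * u) + 2 * u = (t + 1) * (2 * u) by ring]
  field_simp

/-- `ζ(α) → 2/(e·ln 2)` as `α → ∞`. -/
theorem stmt_1 :
    Tendsto zeta atTop (nhds (2 / (Real.exp 1 * Real.log 2))) := by
  have hmul := tendsto_mul_rpow_inv_sub_one_atTop (a := 2) two_pos
  have hzero : Tendsto (fun t : ℝ => (2 : ℝ) ^ t⁻¹ - 1) atTop (nhds 0) := by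
    have h := tendsto_inv_atTop_zero.mul hmul
    rw [zero_mul] at h
    refine h.congr' ?_
    filter_upwards [eventually_gt_atTop 0] with t ht
    field_simp
  have hpow : Tendsto (fun t : ℝ => (1 + 2 * ((2 : ℝ) ^ t⁻¹ - 1)) ^ t) atTop (nhds 4) := by
    have h := Real.tendsto_one_add_rpow_exp_of_tendsto (g := fun t => 2 * ((2 : ℝ) ^ t⁻¹ - 1))
      ((hmul.const_mul 2).congr fun t => by ring)
    rwa [two_mul, Real.exp_add, Real.exp_log two_pos, show (2 : ℝ) * 2 = 4 by norm_num] at h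
  have hlim := (((Real.tendsto_one_add_div_rpow_exp 1).inv₀ (Real.exp_ne_zero 1)).mul hpow).mul
    ((hzero.const_mul 2).const_add 1) |>.div ((hmul.const_mul 2).add (hzero.const_mul 2))
    (by have := Real.log_pos one_lt_two; positivity)
  have hshift : Tendsto (fun t => zeta (t + 1)) atTop
      (nhds (2 / (Real.exp 1 * Real.log 2))) := by
    convert hlim.congr' ?_ using 2
    · field_simp
      ring
    · filter_upwards [eventually_gt_atTop 0] with t ht
      exact (zeta_add_one ht).symm
  simpa [Function.comp_def] using hshift.comp (tendsto_atTop_add_const_right _ (-1) tendsto_id)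
end

section
/- The infimum of λ/κ over all pairs of positive reals λ, κ such that for all x, y ∈ ℝ and each p ∈ {1, 2} the inequality e^x·(y − x)/p ≤ λ·e^y − κ·e^x holds, is exactly 2/(e·ln 2); moreover this infimum is attained at λ = 2/e and κ = ln 2. -/
/-- Dividing the suitability inequality for the exponential by `e ^ x`. -/
lemma exp_suitable_iff (lam kappa p : ℝ) :
    (∀ x y : ℝ, Real.exp x * (y - x) / p ≤ lam * Real.exp y - kappa * Real.exp x) ↔
      ∀ t : ℝ, t / p + kappa ≤ lam * Real.exp t := by
  constructor
  · intro h t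
    have h0 := h 0 t
    simp only [Real.exp_zero, sub_zero, one_mul, mul_one] at h0
    linarith
  · intro h x y
    have hxy := mul_le_mul_of_nonneg_left (h (y - x)) (Real.exp_pos x).le
    have he : Real.exp x * Real.exp (y - x) = Real.exp y := by
      rw [← Real.exp_add, add_sub_cancel]
    calc Real.exp x * (y - x) / p
        = Real.exp x * ((y - x) / p + kappa) - kappa * Real.exp x := by ring
      _ ≤ Real.exp x * (lam * Real.exp (y - x)) - kappa * Real.exp x := by linarith
      _ = lam * Real.exp y - kappa * Real.exp x := by rw [← he]; ring

lemma exp_sub_one_add_log_two (t : ℝ) :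
    Real.exp (t - 1 + Real.log 2) = 2 / Real.exp 1 * Real.exp t := by
  rw [Real.exp_add, Real.exp_sub, Real.exp_log two_pos]
  ring

/-- The exponential is `(2 / e, log 2)`-suitable. -/
lemma exp_suitable (p : ℝ) (hp : p ∈ ({1, 2} : Set ℝ)) (x y : ℝ) :
    Real.exp x * (y - x) / p ≤ (2 / Real.exp 1) * Real.exp y - Real.log 2 * Real.exp x := by
  refine (exp_suitable_iff _ _ _).2 (fun t => ?_) x y
  rcases hp with rfl | rfl
  · linarith [exp_sub_one_add_log_two t, Real.add_one_le_exp (t - 1 + Real.log 2)]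
  · have h := Real.add_one_le_exp (t - 1 + Real.log 2 + Real.log 2)
    rw [Real.exp_add, Real.exp_log two_pos, exp_sub_one_add_log_two] at h
    linarith

/-- Testing suitability where equality holds for `(2 / e, log 2)` bounds `kappa`. -/
lemma two_mul_le_of_exp_suitable {lam kappa : ℝ}
    (h : ∀ p ∈ ({1, 2} : Set ℝ), ∀ x y : ℝ,
      Real.exp x * (y - x) / p ≤ lam * Real.exp y - kappa * Real.exp x) :
    2 * kappa ≤ lam * (Real.exp 1 * Real.log 2) := by
  have h1 := (exp_suitable_iff _ _ _).1 (h 1 (by simp)) (1 - Real.log 2)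
  have h2 := (exp_suitable_iff _ _ _).1 (h 2 (by simp)) (1 - Real.log 2 - Real.log 2)
  simp only [Real.exp_sub, Real.exp_log two_pos] at h1 h2
  have hl : 0 ≤ 1 - Real.log 2 := by linarith [Real.log_two_lt_d9]
  have hg : 0 ≤ 2 * Real.log 2 - 1 := by linarith [Real.log_two_gt_d9]
  nlinarith [mul_le_mul_of_nonneg_left h1 hg, mul_le_mul_of_nonneg_left h2 hl]

/-- The infimum of `λ/κ` over positive pairs `(λ, κ)` such that the
exponential function is `(λ, κ)`-suitable (i.e. `e^x·(y−x)/p ≤ λ·e^y − κ·e^x` for all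
`x, y` and `p ∈ {1,2}`) equals `2/(e·ln 2)`, and it is attained at `λ = 2/e`, `κ = ln 2`. -/
theorem stmt_2 :
    IsLeast {r : ℝ | ∃ lam kappa : ℝ, 0 < lam ∧ 0 < kappa ∧
        (∀ p ∈ ({1, 2} : Set ℝ), ∀ x y : ℝ,
          Real.exp x * (y - x) / p ≤ lam * Real.exp y - kappa * Real.exp x) ∧
        r = lam / kappa}
      (2 / (Real.exp 1 * Real.log 2)) ∧
    (0 < (2 / Real.exp 1 : ℝ) ∧ 0 < Real.log 2 ∧
      (∀ p ∈ ({1, 2} : Set ℝ), ∀ x y : ℝ,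
        Real.exp x * (y - x) / p ≤ (2 / Real.exp 1) * Real.exp y - Real.log 2 * Real.exp x) ∧
      (2 / Real.exp 1) / Real.log 2 = 2 / (Real.exp 1 * Real.log 2)) := by
  have hlog : 0 < Real.log 2 := Real.log_pos one_lt_two
  have he := Real.exp_pos 1
  refine ⟨⟨⟨2 / Real.exp 1, Real.log 2, by positivity, hlog, exp_suitable,
    (div_div _ _ _).symm⟩, ?_⟩, by positivity, hlog, exp_suitable, div_div _ _ _⟩
  rintro _ ⟨lam, kappa, -, hkappa, h, rfl⟩
  rw [div_le_div_iff₀ (by positivity) hkappa]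
  exact two_mul_le_of_exp_suitable h
end

section
/- Let f : ℝ → ℝ be differentiable, convex, and eventually strictly increasing on the positive reals (i.e., there exists L such that f is strictly increasing on [L, ∞)). If f is (λ, κ, p)-suitable for some reals λ, κ and some p > 0, then for every c ∈ ℝ the inequality c/p ≤ λ·e^c − κ holds. -/
open Filter Topology Set

/-- If an increasing unbounded `h` satisfies `h (y + c) - h y ≤ k * h' y` for all large `y`,
then `c ≤ k`. -/
theorem le_of_shift_sub_le_mul_deriv {h h' : ℝ → ℝ} {m c k : ℝ}
    (hmono : MonotoneOn h (Ici m)) (hder : ∀ y, m ≤ y → HasDerivAt h (h' y) y)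
    (htop : Tendsto h atTop atTop)
    (hle : ∀ y, m + |c| ≤ y → h (y + c) - h y ≤ k * h' y) : c ≤ k := by
  obtain ⟨H, hH⟩ : ∃ H : ℝ → ℝ, ∀ y, m ≤ y → HasDerivAt H (h y) y := by
    have hcont : Continuous fun y => h (max y m) :=
      continuous_iff_continuousAt.2 fun y =>
        ContinuousAt.comp (f := fun y => max y m) (g := h)
          (hder _ (le_max_right y m)).continuousAt (by fun_prop)
    refine ⟨fun y => ∫ t in m..y, h (max t m), fun y hy => ?_⟩
    simpa [max_eq_left hy] using (hcont.integral_hasStrictDerivAt m y).hasDerivAt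
  have hc := neg_abs_le c
  have hc0 := abs_nonneg c
  have hconvex : ∀ y, m + |c| ≤ y → c * h y ≤ H (y + c) - H y := by
    intro y hy
    rcases lt_trichotomy c 0 with hneg | rfl | hpos
    · obtain ⟨ξ, hξ, he⟩ := exists_hasDerivAt_eq_slope H h (a := y + c) (b := y) (by linarith)
        (fun x hx => (hH x (by linarith [hx.1])).continuousAt.continuousWithinAt)
        (fun x hx => hH x (by linarith [hx.1]))
      have hξy : h ξ ≤ h y :=
        hmono (mem_Ici.2 (by linarith [hξ.1])) (mem_Ici.2 (by linarith)) hξ.2.le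
      rw [eq_div_iff (by linarith)] at he
      nlinarith
    · simp
    · obtain ⟨ξ, hξ, he⟩ := exists_hasDerivAt_eq_slope H h (a := y) (b := y + c) (by linarith)
        (fun x hx => (hH x (by linarith [hx.1])).continuousAt.continuousWithinAt)
        (fun x hx => hH x (by linarith [hx.1]))
      have hξy : h y ≤ h ξ :=
        hmono (mem_Ici.2 (by linarith)) (mem_Ici.2 (by linarith [hξ.1])) hξ.1.le
      rw [eq_div_iff (by linarith)] at he
      nlinarith
  have hG : ∀ y, m + |c| ≤ y → HasDerivAt (fun y => H (y + c) - H y - k * h y)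
      (h (y + c) - h y - k * h' y) y := fun y hy =>
    (((hH (y + c) (by linarith)).comp_add_const y c).sub (hH y (by linarith))).sub
      ((hder y (by linarith)).const_mul k)
  have hanti : AntitoneOn (fun y => H (y + c) - H y - k * h y) (Ici (m + |c|)) := by
    refine antitoneOn_of_deriv_nonpos (convex_Ici _)
      (fun y hy => (hG y hy).continuousAt.continuousWithinAt)
      (fun y hy => (hG y (interior_subset hy)).differentiableAt.differentiableWithinAt)
      (fun y hy => ?_)
    rw [(hG y (interior_subset hy)).deriv]
    linarith [hle y (interior_subset hy)]
  by_contra! hk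
  have hlarge : Tendsto (fun y => (c - k) * h y) atTop atTop :=
    htop.const_mul_atTop (by linarith)
  obtain ⟨y, hy, hym⟩ := ((hlarge.eventually_gt_atTop
    (H (m + |c| + c) - H (m + |c|) - k * h (m + |c|))).and
      (eventually_ge_atTop (m + |c|))).exists
  have h1 := hanti self_mem_Ici (mem_Ici.2 hym) hym
  have h2 := hconvex y hym
  simp only at h1
  linarith

theorem ConvexOn.add_deriv_mul_sub_le {f : ℝ → ℝ} (hf : Differentiable ℝ f)
    (hconv : ConvexOn ℝ univ f) (a b : ℝ) : f a + deriv f a * (b - a) ≤ f b := by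
  rcases lt_trichotomy a b with hab | rfl | hab
  · have := hconv.deriv_le_slope (mem_univ a) (mem_univ b) hab (hf a)
    rw [slope_def_field, le_div_iff₀ (by linarith)] at this
    linarith
  · simp
  · have := hconv.slope_le_deriv (mem_univ b) (mem_univ a) hab (hf a)
    rw [slope_def_field, div_le_iff₀ (by linarith)] at this
    linarith

/-- A positive function with positive derivative on `[L, ∞)` that tends to infinity has a
logarithmic inverse `h`, with `f (h y) = exp y`. -/
theorem exists_log_inverse {f : ℝ → ℝ} {L : ℝ} (hf : Differentiable ℝ f)
    (hmono : StrictMonoOn f (Ici L)) (hpos : 0 < f L) (hd : ∀ x, L ≤ x → 0 < deriv f x)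
    (htop : Tendsto f atTop atTop) :
    ∃ (h : ℝ → ℝ) (m : ℝ), MonotoneOn h (Ici m) ∧
      (∀ y, m ≤ y → f (h y) = Real.exp y ∧ 0 < deriv f (h y) ∧
        HasDerivAt h (Real.exp y / deriv f (h y)) y) ∧ Tendsto h atTop atTop := by
  have hex : ∀ y, ∃ x, Real.log (f L) ≤ y → L ≤ x ∧ f x = Real.exp y := by
    intro y
    by_cases hy : Real.log (f L) ≤ y
    · have hy' : f L ≤ Real.exp y := (Real.log_le_iff_le_exp hpos).1 hy
      obtain ⟨M, hM, hLM⟩ :=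
        ((htop.eventually_ge_atTop (Real.exp y)).and (eventually_ge_atTop L)).exists
      obtain ⟨x, hx, hxe⟩ := intermediate_value_Icc hLM hf.continuous.continuousOn ⟨hy', hM⟩
      exact ⟨x, fun _ => ⟨hx.1, hxe⟩⟩
    · exact ⟨0, fun h => absurd h hy⟩
  choose h hh using hex
  have hsm : StrictMonoOn h (Ici (Real.log (f L))) := by
    intro y hy z hz hyz
    rw [← hmono.lt_iff_lt (hh y hy).1 (hh z hz).1, (hh y hy).2, (hh z hz).2]
    exact Real.exp_lt_exp.2 hyz
  have hleft : ∀ x, L ≤ x → Real.log (f L) ≤ Real.log (f x) ∧ h (Real.log (f x)) = x := by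
    intro x hx
    have hfx : f L ≤ f x := hmono.monotoneOn self_mem_Ici hx hx
    have hlog := Real.log_le_log hpos hfx
    refine ⟨hlog, hmono.injOn (hh _ hlog).1 hx ?_⟩
    rw [(hh _ hlog).2, Real.exp_log (by linarith)]
  refine ⟨h, Real.log (f L) + 1, hsm.monotoneOn.mono (Ici_subset_Ici.2 (by linarith)), ?_, ?_⟩
  · intro y hy
    have hy0 : Real.log (f L) < y := by linarith
    obtain ⟨hL, he⟩ := hh y hy0.le
    refine ⟨he, hd _ hL, ?_⟩
    have hLy : L < h y := by
      rw [← (hleft L le_rfl).2]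
      exact hsm self_mem_Ici hy0.le hy0
    have hcont : ContinuousAt h y := by
      refine hsm.continuousAt_of_image_mem_nhds (Ici_mem_nhds hy0)
        (mem_of_superset (Ici_mem_nhds hLy) fun x hx => ?_)
      exact ⟨_, (hleft x hx).1, (hleft x hx).2⟩
    have hlogder : HasDerivAt (fun x => Real.log (f x)) (deriv f (h y) / f (h y)) (h y) :=
      (hf (h y)).hasDerivAt.log (by rw [he]; positivity)
    have hne : deriv f (h y) / f (h y) ≠ 0 := by
      rw [he]
      exact (div_pos (hd _ hL) (Real.exp_pos y)).ne'
    have := hlogder.of_local_left_inverse hcont hne (by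
      filter_upwards [Ici_mem_nhds hy0] with z hz
      rw [(hh z hz).2, Real.log_exp])
    rwa [inv_div, he] at this
  · refine tendsto_atTop.2 fun B => ?_
    filter_upwards [eventually_ge_atTop (Real.log (f (max B L)))] with y hy
    obtain ⟨h1, h2⟩ := hleft (max B L) (le_max_right _ _)
    calc B ≤ max B L := le_max_left _ _
      _ = h (Real.log (f (max B L))) := h2.symm
      _ ≤ h y := hsm.monotoneOn h1 (h1.trans hy) hy


/-- Scalar `(λ, κ, p)`-suitability: `f′(a)·(b − a)/p ≤ λ·f(b) − κ·f(a)` for all `a, b ∈ ℝ`. -/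
def SuitableR (f : ℝ → ℝ) (lam kappa p : ℝ) : Prop :=
  ∀ a b : ℝ, deriv f a * (b - a) / p ≤ lam * f b - kappa * f a

/-- if `f : ℝ → ℝ` is differentiable, convex, eventually strictly increasing
on the positive reals, and `(λ, κ, p)`-suitable for some `p > 0`, then
`c/p ≤ λ·e^c − κ` holds for every real `c`. -/
theorem stmt_7 {lam kappa p : ℝ} (hp : 0 < p)
    {f : ℝ → ℝ} (hf : Differentiable ℝ f) (hconv : ConvexOn ℝ Set.univ f)
    (hinc : ∃ L : ℝ, StrictMonoOn f (Set.Ici L))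
    (hfs : SuitableR f lam kappa p) :
    ∀ c : ℝ, c / p ≤ lam * Real.exp c - kappa := by
  intro c
  obtain ⟨L₀, hL₀⟩ := hinc
  have hd : ∀ x, L₀ < x → 0 < deriv f x := by
    intro x hx
    have h1 := hconv.add_deriv_mul_sub_le hf x L₀
    have h2 := hL₀ self_mem_Ici hx.le hx
    nlinarith
  have htop : Tendsto f atTop atTop := by
    refine tendsto_atTop_mono (hconv.add_deriv_mul_sub_le hf (L₀ + 1)) ?_
    exact tendsto_atTop_add_const_left _ _
      ((tendsto_atTop_add_const_right _ _ tendsto_id).const_mul_atTop (hd _ (by linarith)))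
  obtain ⟨L, hfL, hL⟩ :=
    ((htop.eventually_gt_atTop 0).and (eventually_gt_atTop L₀)).exists
  obtain ⟨h, m, hmono, hh, hhtop⟩ := exists_log_inverse hf
    (hL₀.mono (Ici_subset_Ici.2 hL.le)) hfL (fun x hx => hd x (hL.trans_le hx)) htop
  have key : c ≤ (lam * Real.exp c - kappa) * p := by
    refine le_of_shift_sub_le_mul_deriv hmono (fun y hy => (hh y hy).2.2) hhtop fun y hy => ?_
    obtain ⟨he, hpos, -⟩ := hh y (by linarith [abs_nonneg c])
    have hs := hfs (h y) (h (y + c))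
    rw [he, (hh (y + c) (by linarith [neg_abs_le c])).1, Real.exp_add, div_le_iff₀ hp] at hs
    rw [← mul_div_assoc, le_div_iff₀ hpos]
    linarith
  rwa [div_le_iff₀ hp]
end

section
/- Let M ∈ ℝ and let h : [M, ∞) → ℝ be continuous and everywhere positive with ∫_M^∞ h(x) dx = ∞. Then for every c ∈ ℝ and every ε > 0 there exists z ∈ [max(M, M − c), ∞) such that (∫_z^{z+c} h(x) dx) / h(z) ≥ c − ε. -/
open Filter

/-- For monotone `H`, the oriented integral over `[T, T + c]` is at least `c * H T`,
whatever the sign of `c`. -/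
lemma Monotone.mul_le_intervalIntegral_add {H : ℝ → ℝ} (hH : Monotone H) (T c : ℝ) :
    c * H T ≤ ∫ x in T..(T + c), H x := by
  rcases le_total 0 c with hc | hc
  · have := intervalIntegral.integral_mono_on (μ := MeasureTheory.volume)
      (f := fun _ => H T) (g := H) (a := T) (b := T + c) (by linarith)
      (by simp) hH.intervalIntegrable (fun x hx => hH hx.1)
    simpa using this
  · have := intervalIntegral.integral_mono_on (μ := MeasureTheory.volume)
      (f := H) (g := fun _ => H T) (a := T + c) (b := T) (by linarith)
      hH.intervalIntegrable (by simp) (fun x hx => hH hx.2)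
    rw [intervalIntegral.integral_symm]
    simp only [intervalIntegral.integral_const, smul_eq_mul] at this
    linarith

/-- A nonnegative continuous function `g` whose primitive tends to infinity cannot satisfy
`∫ x in z..(z + c), g x ≤ (c - ε) * g z` for all large `z`. -/
lemma exists_mul_lt_intervalIntegral_add {g : ℝ → ℝ} (hg : Continuous g) (hg0 : ∀ x, 0 ≤ g x)
    {M : ℝ} (hdiv : Tendsto (fun T => ∫ x in M..T, g x) atTop atTop)
    (a c : ℝ) {ε : ℝ} (hε : 0 < ε) :
    ∃ z, a ≤ z ∧ (c - ε) * g z < ∫ x in z..(z + c), g x := by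
  by_contra! hcon
  set H : ℝ → ℝ := fun T => ∫ x in M..T, g x with hH
  have hHd (x : ℝ) : HasDerivAt H (g x) x := hg.integral_hasStrictDerivAt M x |>.hasDerivAt
  have hHc : Continuous H := continuous_iff_continuousAt.2 fun x => (hHd x).continuousAt
  have hHm : Monotone H := monotone_of_hasDerivAt_nonneg hHd hg0
  have hKd (x : ℝ) : HasDerivAt (fun T => ∫ x in M..T, H x) (H x) x :=
    hHc.integral_hasStrictDerivAt M x |>.hasDerivAt
  set G : ℝ → ℝ := fun T =>
    (∫ x in M..(T + c), H x) - (∫ x in M..T, H x) - (c - ε) * H T with hG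
  have hGd (x : ℝ) : HasDerivAt G (H (x + c) - H x - (c - ε) * g x) x :=
    (((hKd (x + c)).comp_add_const x c).sub (hKd x)).sub ((hHd x).const_mul _)
  have hanti : AntitoneOn G (Set.Ici a) := by
    refine antitoneOn_of_deriv_nonpos (convex_Ici a)
      (fun x _ => (hGd x).continuousAt.continuousWithinAt)
      (fun x _ => (hGd x).differentiableAt.differentiableWithinAt) fun x hx => ?_
    rw [interior_Ici] at hx
    rw [(hGd x).deriv, hH, intervalIntegral.integral_interval_sub_left
      (hg.intervalIntegrable _ _) (hg.intervalIntegrable _ _)]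
    linarith [hcon x (le_of_lt hx)]
  obtain ⟨T, hT, haT⟩ :=
    ((hdiv.eventually_gt_atTop (G a / ε)).and (eventually_ge_atTop a)).exists
  have hle : G T ≤ G a := hanti Set.self_mem_Ici haT haT
  have hge := hHm.mul_le_intervalIntegral_add T c
  rw [← intervalIntegral.integral_interval_sub_left (hHc.intervalIntegrable M _)
    (hHc.intervalIntegrable M _)] at hge
  have hlt : G a < H T * ε := (div_lt_iff₀ hε).1 hT
  simp only [hG] at hle hlt
  linarith

/-- for `h` continuous and positive on `[M, ∞)` with divergent improper
integral, for every `c ∈ ℝ` and `ε > 0` there exists `z ≥ max(M, M − c)` with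
`(∫_z^{z+c} h) / h(z) ≥ c − ε`. -/
theorem stmt_8 {M : ℝ} {h : ℝ → ℝ} (hcont : ContinuousOn h (Set.Ici M))
    (hpos : ∀ x ∈ Set.Ici M, 0 < h x)
    (hdiv : Tendsto (fun T => ∫ x in M..T, h x) atTop atTop) :
    ∀ c : ℝ, ∀ ε : ℝ, 0 < ε →
      ∃ z : ℝ, max M (M - c) ≤ z ∧ c - ε ≤ (∫ x in z..(z + c), h x) / h z := by
  intro c ε hε
  set g : ℝ → ℝ := fun x => h (max M x) with hg
  have hgc : Continuous g :=
    hcont.comp_continuous (by fun_prop) fun x => le_max_left M x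
  have hgh {x : ℝ} (hx : M ≤ x) : g x = h x := by simp [hg, hx]
  have hint {u v : ℝ} (hu : M ≤ u) (hv : M ≤ v) : ∫ x in u..v, g x = ∫ x in u..v, h x :=
    intervalIntegral.integral_congr fun x hx => hgh ((le_inf hu hv).trans hx.1)
  have hgdiv : Tendsto (fun T => ∫ x in M..T, g x) atTop atTop :=
    hdiv.congr' ((eventually_ge_atTop M).mono fun T hT => (hint le_rfl hT).symm)
  obtain ⟨z, hz, hlt⟩ := exists_mul_lt_intervalIntegral_add hgc
    (fun x => (hpos _ (le_max_left M x)).le) hgdiv (max M (M - c)) c hε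
  have hMz : M ≤ z := (le_max_left _ _).trans hz
  have hMzc : M ≤ z + c := by linarith [(le_max_right M (M - c)).trans hz]
  rw [hgh hMz, hint hMz hMzc] at hlt
  exact ⟨z, hz, (le_div_iff₀ (hpos z hMz)).2 hlt.le⟩
end

section
/- Let M ∈ ℝ and let h : [M, ∞) → ℝ be continuous and everywhere positive with ∫_M^∞ h(x) dx = ∞. Then for every ε > 0 there exists z ∈ [M + 1, ∞) such that ∫_{z−1}^z h(x) dx ≤ (1 + ε)·h(z). -/
open Filter

/-- A continuous positive function on `ℝ` with divergent improper integral cannot satisfy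
`c * g z ≤ ∫_{z-1}^z g` for all large `z` when `1 < c`. -/
theorem exists_integral_le_mul_of_tendsto_atTop {M c : ℝ} {g : ℝ → ℝ} (hg : Continuous g)
    (hpos : ∀ x, 0 < g x) (hdiv : Tendsto (fun T => ∫ x in M..T, g x) atTop atTop)
    (hc : 1 < c) :
    ∃ z : ℝ, M + 1 ≤ z ∧ (∫ x in (z - 1)..z, g x) ≤ c * g z := by
  by_contra! hlt
  set H : ℝ → ℝ := fun T => ∫ x in M..T, g x with hH
  have hHd (z : ℝ) : HasDerivAt H (g z) z := hg.integral_hasStrictDerivAt M z |>.hasDerivAt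
  have hHc : Continuous H := continuous_iff_continuousAt.2 fun z => (hHd z).continuousAt
  have hHm : Monotone H := monotone_of_hasDerivAt_nonneg hHd fun z => (hpos z).le
  set K : ℝ → ℝ := fun T => ∫ x in M..T, H x with hK
  have hKd (z : ℝ) : HasDerivAt K (H z) z := hHc.integral_hasStrictDerivAt M z |>.hasDerivAt
  have hFd (z : ℝ) : HasDerivAt (fun z => K z - K (z - 1) - c * H z)
      (H z - H (z - 1) - c * g z) z :=
    ((hKd z).sub ((hKd (z - 1)).comp_sub_const z 1)).sub ((hHd z).const_mul c)
  have hmono : MonotoneOn (fun z => K z - K (z - 1) - c * H z) (Set.Ici (M + 1)) := by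
    refine monotoneOn_of_deriv_nonneg (convex_Ici _)
      (fun z _ => (hFd z).continuousAt.continuousWithinAt)
      (fun z _ => (hFd z).differentiableAt.differentiableWithinAt) fun z hz => ?_
    rw [interior_Ici, Set.mem_Ioi] at hz
    have h₁ := hlt z hz.le
    rw [(hFd z).deriv]
    have h₂ : H z - H (z - 1) = ∫ x in (z - 1)..z, g x :=
      intervalIntegral.integral_interval_sub_left (hg.intervalIntegrable _ _)
        (hg.intervalIntegrable _ _)
    linarith
  have hKle (z : ℝ) : K z - K (z - 1) ≤ H z := by
    have h₁ : K z - K (z - 1) = ∫ x in (z - 1)..z, H x :=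
      intervalIntegral.integral_interval_sub_left (hHc.intervalIntegrable _ _)
        (hHc.intervalIntegrable _ _)
    have h₂ : ∫ x in (z - 1)..z, H x ≤ ∫ _ in (z - 1)..z, H z :=
      intervalIntegral.integral_mono_on (by linarith) (hHc.intervalIntegrable _ _)
        intervalIntegrable_const fun x hx => hHm hx.2
    rw [intervalIntegral.integral_const] at h₂
    simpa [h₁] using h₂
  obtain ⟨z, hz, hzH⟩ := ((eventually_ge_atTop (M + 1)).and
    ((hdiv.const_mul_atTop (sub_pos.2 hc)).eventually_gt_atTop
      (-(K (M + 1) - K (M + 1 - 1) - c * H (M + 1))))).exists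
  have h₁ := hmono Set.self_mem_Ici (Set.mem_Ici.2 hz) hz
  have h₂ := hKle z
  change _ < (c - 1) * H z at hzH
  dsimp only at h₁
  linarith

/-- for `h` continuous and positive on `[M, ∞)` with divergent improper
integral, for every `ε > 0` there exists `z ≥ M + 1` with
`∫_{z−1}^z h ≤ (1 + ε)·h(z)`. -/
theorem stmt_9 {M : ℝ} {h : ℝ → ℝ} (hcont : ContinuousOn h (Set.Ici M))
    (hpos : ∀ x ∈ Set.Ici M, 0 < h x)
    (hdiv : Tendsto (fun T => ∫ x in M..T, h x) atTop atTop) :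
    ∀ ε : ℝ, 0 < ε →
      ∃ z : ℝ, M + 1 ≤ z ∧ (∫ x in (z - 1)..z, h x) ≤ (1 + ε) * h z := by
  intro ε hε
  have hint {a b : ℝ} (ha : M ≤ a) (hab : a ≤ b) :
      ∫ x in a..b, h (max M x) = ∫ x in a..b, h x := by
    refine intervalIntegral.integral_congr fun x hx => ?_
    rw [Set.uIcc_of_le hab] at hx
    simp only [max_eq_right (ha.trans hx.1)]
  obtain ⟨z, hz, hle⟩ := exists_integral_le_mul_of_tendsto_atTop (M := M) (c := 1 + ε)
    (g := fun x => h (max M x))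
    (hcont.comp_continuous (by fun_prop) fun x => le_max_left M x)
    (fun x => hpos _ (le_max_left M x))
    (hdiv.congr' ((eventually_ge_atTop M).mono fun T hT => (hint le_rfl hT).symm))
    (by linarith)
  refine ⟨z, hz, ?_⟩
  rwa [hint (by linarith) (by linarith), max_eq_right (by linarith)] at hle
end

section
/- Let M ∈ ℝ and let h : [M, ∞) → ℝ be continuous and everywhere positive with ∫_M^∞ h(x) dx = ∞. Then for every ε > 0 there exists z ∈ [M, ∞) such that ∫_z^{z+1} h(x) dx ≥ (1 − ε)·h(z). -/
open Filter

/-- If `F` is a primitive of the continuous function `g`, and the increments of `F` over unit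
intervals in `[M, ∞)` are at most `c * g`, then `c * F z - F z` is bounded below on `[M, ∞)`
as soon as `F` is monotone there. -/
theorem exists_le_mul_sub_of_sub_le_mul {M c : ℝ} {F g : ℝ → ℝ}
    (hF : ∀ x, HasDerivAt F (g x) x) (hmono : MonotoneOn F (Set.Ici M))
    (hle : ∀ x, M ≤ x → F (x + 1) - F x ≤ c * g x) :
    ∃ B : ℝ, ∀ x, M ≤ x → B ≤ c * F x - F x := by
  have hFc : Continuous F := continuous_iff_continuousAt.2 fun x => (hF x).continuousAt
  have hΦ : ∀ x, HasDerivAt (fun u => ∫ t in M..u, F t) (F x) x := fun x =>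
    hFc.integral_hasStrictDerivAt M x |>.hasDerivAt
  set Φ : ℝ → ℝ := fun u => ∫ t in M..u, F t with hΦdef
  have hG : ∀ x, HasDerivAt (fun u => c * F u - (Φ (u + 1) - Φ u))
      (c * g x - (F (x + 1) - F x)) x := fun x =>
    ((hF x).const_mul c).sub (((hΦ (x + 1)).comp_add_const x 1).sub (hΦ x))
  have hGmono : MonotoneOn (fun u => c * F u - (Φ (u + 1) - Φ u)) (Set.Ici M) := by
    refine monotoneOn_of_hasDerivWithinAt_nonneg (convex_Ici M)
      (fun x _ => (hG x).continuousAt.continuousWithinAt)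
      (fun x _ => (hG x).hasDerivWithinAt) fun x hx => ?_
    rw [interior_Ici] at hx
    exact sub_nonneg.2 (hle x (le_of_lt hx))
  refine ⟨c * F M - (Φ (M + 1) - Φ M), fun x hx => ?_⟩
  have hFΦ : F x ≤ Φ (x + 1) - Φ x := by
    rw [hΦdef, intervalIntegral.integral_interval_sub_left
      (hFc.intervalIntegrable _ _) (hFc.intervalIntegrable _ _)]
    have := intervalIntegral.integral_mono_on (μ := MeasureTheory.volume) (a := x) (b := x + 1)
      (f := fun _ => F x) (g := F)
      (by linarith) (continuous_const.intervalIntegrable _ _) (hFc.intervalIntegrable _ _)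
      fun t ht => hmono hx (hx.trans ht.1) ht.1
    simpa using this
  have := hGmono Set.self_mem_Ici hx hx
  dsimp only at this
  linarith

/-- for `h` continuous and positive on `[M, ∞)` with divergent improper
integral, for every `ε > 0` there exists `z ≥ M` with
`∫_z^{z+1} h ≥ (1 − ε)·h(z)`. -/
theorem stmt_10 {M : ℝ} {h : ℝ → ℝ} (hcont : ContinuousOn h (Set.Ici M))
    (hpos : ∀ x ∈ Set.Ici M, 0 < h x)
    (hdiv : Tendsto (fun T => ∫ x in M..T, h x) atTop atTop) :
    ∀ ε : ℝ, 0 < ε →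
      ∃ z : ℝ, M ≤ z ∧ (1 - ε) * h z ≤ ∫ x in z..(z + 1), h x := by
  intro ε hε
  by_contra! hlt
  set g : ℝ → ℝ := fun x => h (max M x) with hg
  have hgc : Continuous g :=
    hcont.comp_continuous (continuous_const.max continuous_id) fun x => le_max_left M x
  have hgh : ∀ x, M ≤ x → g x = h x := fun x hx => by rw [hg]; simp only [max_eq_right hx]
  have hint : ∀ a b, M ≤ a → a ≤ b → ∫ x in a..b, g x = ∫ x in a..b, h x := fun a b ha hab =>
    intervalIntegral.integral_congr fun x hx => by
      rw [Set.uIcc_of_le hab] at hx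
      exact hgh x (ha.trans hx.1)
  have hF : ∀ x, HasDerivAt (fun u => ∫ t in M..u, g t) (g x) x := fun x =>
    (hgc.integral_hasStrictDerivAt M x).hasDerivAt
  have hmono : Monotone fun u => ∫ t in M..u, g t :=
    monotone_of_hasDerivAt_nonneg hF fun x => (hpos _ (le_max_left M x)).le
  obtain ⟨B, hB⟩ := exists_le_mul_sub_of_sub_le_mul (M := M) (c := 1 - ε) hF
    (hmono.monotoneOn _) fun x hx => by
      rw [intervalIntegral.integral_interval_sub_left
        (hgc.intervalIntegrable _ _) (hgc.intervalIntegrable _ _),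
        hint x (x + 1) hx (by linarith), hgh x hx]
      exact (hlt x hx).le
  obtain ⟨T, hT, hMT⟩ :=
    ((hdiv.eventually_gt_atTop (-B / ε)).and (eventually_ge_atTop M)).exists
  have hBT := hB T hMT
  rw [hint M T le_rfl hMT] at hBT
  rw [div_lt_iff₀ hε] at hT
  linarith
end

section
/- For real α > 1, the minimum of λ/κ over all pairs of positive reals λ, κ such that the function x ↦ |x|^α on ℝ is (λ, κ)-suitable equals ζ(α) = ((α − 1)^(α−1) / α^α) · ((2^(α/(α−1)) − 1)^α / (2^(α/(α−1)) − 2)). -/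
lemma rpow_eq_rpow_sub_one_mul {α x : ℝ} (hx : 0 < x) : x ^ α = x ^ (α - 1) * x := by
  rw [← Real.rpow_add_one hx.ne', sub_add_cancel]

lemma deriv_abs_rpow_mul_self {α : ℝ} (hα : 1 < α) (a : ℝ) :
    deriv (fun x : ℝ => |x| ^ α) a * a = α * |a| ^ α := by
  rw [(hasDerivAt_abs_rpow a hα).deriv]
  rcases eq_or_ne a 0 with rfl | ha
  · simp [Real.zero_rpow (by linarith : α ≠ 0)]
  · have hpos : 0 < |a| := abs_pos.mpr ha
    rw [mul_assoc, mul_assoc, ← abs_mul_abs_self a, ← pow_two, ← Real.rpow_natCast,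
      ← Real.rpow_add hpos]
    norm_num

lemma abs_deriv_abs_rpow {α : ℝ} (hα : 1 < α) (a : ℝ) :
    |deriv (fun x : ℝ => |x| ^ α) a| = α * |a| ^ (α - 1) := by
  rw [(hasDerivAt_abs_rpow a hα).deriv]
  rcases eq_or_ne a 0 with rfl | ha
  · simp [Real.zero_rpow (by linarith : α - 1 ≠ 0)]
  · have hpos : 0 < |a| := abs_pos.mpr ha
    rw [abs_mul, abs_mul, abs_of_pos (by linarith : 0 < α),
      abs_of_nonneg (Real.rpow_nonneg hpos.le _), mul_assoc, ← Real.rpow_add_one hpos.ne']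
    ring_nf

/-- The tangent line to `x ↦ x ^ α` at `t` lies below the graph. -/
lemma tangent_le_rpow {α s t : ℝ} (hα : 1 < α) (hs : 0 ≤ s) (ht : 0 < t) :
    α * (t ^ (α - 1) * s) - (α - 1) * t ^ α ≤ s ^ α := by
  have hst : 0 ≤ s / t := div_nonneg hs ht.le
  have h := one_add_mul_self_le_rpow_one_add (s := s / t - 1) (by linarith) hα.le
  rw [add_sub_cancel, Real.div_rpow hs ht.le, le_div_iff₀ (Real.rpow_pos_of_pos ht α)] at h
  have e : t ^ α = t ^ (α - 1) * t := rpow_eq_rpow_sub_one_mul ht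
  have : (1 + α * (s / t - 1)) * t ^ α = α * (t ^ (α - 1) * s) - (α - 1) * t ^ α := by
    rw [e]; field_simp; ring
  linarith

lemma suitableR_abs_rpow {α lam kappa p τ : ℝ} (hα : 1 < α) (hp : 0 < p) (hlam : 0 < lam)
    (hτ : 0 < τ) (hlamτ : lam * τ ^ (α - 1) = 1 / p)
    (hkappa : kappa ≤ (α - (α - 1) * τ) / p) :
    SuitableR (fun x : ℝ => |x| ^ α) lam kappa p := by
  intro a b
  show deriv (fun x : ℝ => |x| ^ α) a * (b - a) / p ≤ lam * |b| ^ α - kappa * |a| ^ α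
  have hself := deriv_abs_rpow_mul_self hα a
  have habs := abs_deriv_abs_rpow hα a
  set d := deriv (fun x : ℝ => |x| ^ α) a
  have hdb : d * b ≤ α * |a| ^ (α - 1) * |b| := by
    rw [← habs, ← abs_mul]; exact le_abs_self _
  rcases eq_or_ne a 0 with rfl | ha
  · have hd : d = 0 := by
      rw [abs_zero, Real.zero_rpow (by linarith : α - 1 ≠ 0), mul_zero] at habs
      exact abs_eq_zero.mp habs
    simp only [hd, abs_zero, Real.zero_rpow (by linarith : α ≠ 0)]
    simp only [zero_mul, zero_div, mul_zero, sub_zero]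
    positivity
  · have hpos : 0 < |a| := abs_pos.mpr ha
    have htan := mul_le_mul_of_nonneg_left
      (tangent_le_rpow hα (abs_nonneg b) (mul_pos hτ hpos)) hlam.le
    have eτ : τ ^ α = τ ^ (α - 1) * τ := rpow_eq_rpow_sub_one_mul hτ
    rw [Real.mul_rpow hτ.le hpos.le, Real.mul_rpow hτ.le hpos.le, eτ] at htan
    have e : lam * (α * (τ ^ (α - 1) * |a| ^ (α - 1) * |b|)
        - (α - 1) * (τ ^ (α - 1) * τ * |a| ^ α))
        = (lam * τ ^ (α - 1)) * (α * |a| ^ (α - 1) * |b| - (α - 1) * τ * |a| ^ α) := by ring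
    rw [e, hlamτ] at htan
    have hk := mul_le_mul_of_nonneg_right hkappa (Real.rpow_nonneg hpos.le α)
    have hd : d * (b - a) / p ≤ (α * |a| ^ (α - 1) * |b| - α * |a| ^ α) / p := by
      gcongr
      linarith [mul_sub d b a]
    have e' : 1 / p * (α * |a| ^ (α - 1) * |b| - (α - 1) * τ * |a| ^ α)
        = (α * |a| ^ (α - 1) * |b| - α * |a| ^ α) / p
          + (α - (α - 1) * τ) / p * |a| ^ α := by ring
    linarith

lemma SuitableR.kappa_le {α lam kappa p : ℝ} (hα : 1 < α)
    (h : SuitableR (fun x : ℝ => |x| ^ α) lam kappa p) {t : ℝ} (ht : 0 < t) :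
    kappa ≤ lam * t ^ α - α * (t - 1) / p := by
  have h1 := h 1 t
  have hd := deriv_abs_rpow_mul_self hα 1
  simp only [abs_one, Real.one_rpow, mul_one] at hd
  simp only [hd, abs_one, Real.one_rpow, mul_one, abs_of_pos ht] at h1
  linarith

/-- for `α > 1`, the minimum of `λ/κ` over positive pairs `(λ, κ)` such that
`x ↦ |x|^α` is `(λ, κ)`-suitable (i.e. both `(λ, κ, 1)`- and `(λ, κ, 2)`-suitable)
equals `ζ(α)`. -/
theorem stmt_11 {α : ℝ} (hα : 1 < α) :
    IsLeast {r : ℝ | ∃ lam kappa : ℝ, 0 < lam ∧ 0 < kappa ∧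
        SuitableR (fun x : ℝ => |x| ^ α) lam kappa 1 ∧
        SuitableR (fun x : ℝ => |x| ^ α) lam kappa 2 ∧
        r = lam / kappa}
      (zeta α) := by
  have hα0 : 0 < α := by linarith
  have hβ : 0 < α - 1 := by linarith
  set q := α / (α - 1) with hq
  have hqβ : q * (α - 1) = α := div_mul_cancel₀ _ hβ.ne'
  have hq1 : 1 < q := by rw [hq, lt_div_iff₀ hβ]; linarith
  set Q := (2 : ℝ) ^ q with hQ
  have hQq : q ≤ Q - 1 := by
    have := one_add_mul_self_le_rpow_one_add (s := 1) (by norm_num) hq1.le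
    norm_num at this
    linarith
  have hQ2 : 2 < Q := by linarith
  have hQpow : Q ^ (α - 1) = 2 ^ α := by
    rw [hQ, ← Real.rpow_mul zero_le_two, hqβ]
  have hQq' : 2 * (Q - 1) ≤ q * Q := by
    have h1 : Q * (2 : ℝ) ^ (-(q - 1)) = 2 := by
      rw [hQ, ← Real.rpow_add two_pos]; simp
    have h2 : 1 - (q - 1) ≤ (2 : ℝ) ^ (-(q - 1)) := by
      rw [Real.rpow_def_of_pos two_pos]
      have := Real.add_one_le_exp (Real.log 2 * -(q - 1))
      have hl : Real.log 2 ≤ 1 := by linarith [Real.log_two_lt_d9]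
      nlinarith
    nlinarith
  obtain ⟨m, hm⟩ : ∃ m, m = q * Q / (2 * (Q - 1)) := ⟨_, rfl⟩
  have hm1 : 1 ≤ m := by rw [hm, le_div_iff₀ (by linarith)]; linarith
  have hm0 : 0 < m := by linarith
  have hmQ : m * (Q - 1) = q * Q / 2 := by
    rw [hm]; field_simp [(by linarith : Q - 1 ≠ 0)]
  have hmQ2 : 2 * m ≤ Q := by nlinarith
  have hm_lin : (α - 1) * m * (Q - 1) = α * Q / 2 := by
    linear_combination (α - 1) * hmQ + Q / 2 * hqβ
  have hQ1 : Q - 1 ≠ 0 := by linarith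
  have hQ0 : Q ≠ 0 := by linarith
  obtain ⟨kappa, hk⟩ : ∃ kappa, kappa = α - (α - 1) * m := ⟨_, rfl⟩
  have hkQ : kappa = α * (Q - 2) / (2 * (Q - 1)) := by
    rw [hk, eq_div_iff (by positivity)]
    linear_combination -2 * hm_lin
  have hk2 : kappa = (α - (α - 1) * (2 * m / Q)) / 2 := by
    rw [hk]; field_simp
    linear_combination -2 * hm_lin
  have hk0 : 0 < kappa := by
    rw [hkQ]
    exact div_pos (mul_pos hα0 (by linarith)) (by linarith)
  obtain ⟨lam, hl⟩ : ∃ lam, lam = (m ^ (α - 1))⁻¹ := ⟨_, rfl⟩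
  have hmβ : 0 < m ^ (α - 1) := Real.rpow_pos_of_pos hm0 _
  have hl0 : 0 < lam := by rw [hl]; positivity
  have h2β : (2 : ℝ) ^ α = 2 ^ (α - 1) * 2 := rpow_eq_rpow_sub_one_mul two_pos
  have h2β0 : 0 < (2 : ℝ) ^ (α - 1) := Real.rpow_pos_of_pos two_pos _
  have hτ0 : 0 < 2 * m / Q := div_pos (by linarith) (by linarith)
  have hlam1 : lam * m ^ (α - 1) = 1 := by rw [hl]; exact inv_mul_cancel₀ hmβ.ne'
  have hlam2 : lam * (2 * m / Q) ^ (α - 1) = 1 / 2 := by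
    rw [Real.div_rpow (by linarith) (by linarith), Real.mul_rpow zero_le_two hm0.le, hQpow, h2β,
      hl]
    field_simp
  have hzeta : zeta α = lam / kappa := by
    have hQ1' : 0 < Q - 1 := by linarith
    have hQ2' : Q - 2 ≠ 0 := by linarith
    have hαβ : α ^ α = α ^ (α - 1) * α := rpow_eq_rpow_sub_one_mul hα0
    have hQα : (Q - 1) ^ α = (Q - 1) ^ (α - 1) * (Q - 1) :=
      rpow_eq_rpow_sub_one_mul hQ1'
    have hα0' : 0 < α ^ (α - 1) := Real.rpow_pos_of_pos hα0 _
    have hβ0' : 0 < (α - 1) ^ (α - 1) := Real.rpow_pos_of_pos hβ _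
    have hQ0' : 0 < (Q - 1) ^ (α - 1) := Real.rpow_pos_of_pos hQ1' _
    have hmpow : m ^ (α - 1) = α ^ (α - 1) * 2 / ((α - 1) ^ (α - 1) * (Q - 1) ^ (α - 1)) := by
      rw [hm, Real.div_rpow (by positivity) (by positivity),
        Real.mul_rpow (by linarith) (by linarith), Real.mul_rpow zero_le_two hQ1'.le, hQpow, h2β,
        hq, Real.div_rpow hα0.le hβ.le]
      field_simp
    rw [zeta, ← hq, ← hQ, hl, hkQ, hmpow, hαβ, hQα]
    field_simp
  rw [hzeta]
  refine ⟨⟨lam, kappa, hl0, hk0, ?_, ?_, rfl⟩, ?_⟩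
  · exact suitableR_abs_rpow hα one_pos hl0 hm0 (by rw [hlam1, div_one]) (by rw [hk, div_one])
  · exact suitableR_abs_rpow hα two_pos hl0 hτ0 hlam2 hk2.le
  · rintro r ⟨l, k, hl', hk', h1, h2, rfl⟩
    have e1 := h1.kappa_le hα hm0
    have e2 := h2.kappa_le hα hτ0
    have p1 : lam * m ^ α = m := by
      rw [rpow_eq_rpow_sub_one_mul hm0, ← mul_assoc, hlam1, one_mul]
    have p2 : lam * (2 * m / Q) ^ α = m / Q := by
      rw [rpow_eq_rpow_sub_one_mul hτ0, ← mul_assoc, hlam2]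
      ring
    have hτ1 : 2 * m / Q ≤ 1 := by rw [div_le_one (by linarith)]; exact hmQ2
    have c1 : 0 ≤ α * (m - 1) := mul_nonneg hα0.le (by linarith)
    have c2 : 0 ≤ α * (1 - 2 * m / Q) / 2 :=
      div_nonneg (mul_nonneg hα0.le (by linarith)) zero_le_two
    have hc : 0 < α * (m - 1) + α * (1 - 2 * m / Q) / 2 := by
      have : m * (1 - 1 / Q) = q / 2 := by
        field_simp
        linear_combination 2 * hmQ
      have : α * (m - 1) + α * (1 - 2 * m / Q) / 2 = α * (q / 2 - 1 / 2) := by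
        rw [← this]; ring
      rw [this]
      exact mul_pos hα0 (by linarith)
    rw [div_le_div_iff₀ hk0 hk']
    have f1 := mul_le_mul_of_nonneg_left e1 (mul_nonneg hl0.le c2)
    have f2 := mul_le_mul_of_nonneg_left e2 (mul_nonneg hl0.le c1)
    refine le_of_mul_le_mul_left ?_ hc
    have hkm : kappa = m - α * (m - 1) := by rw [hk]; ring
    have hkm2 : kappa = m / Q + α * (1 - 2 * m / Q) / 2 := by rw [hk2]; ring
    generalize α * (m - 1) = x at *
    have e3 : α * (2 * m / Q - 1) / 2 = -(α * (1 - 2 * m / Q) / 2) := by ring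
    rw [e3] at f2
    generalize α * (1 - 2 * m / Q) / 2 = y at *
    rw [div_one] at f1
    calc (x + y) * (lam * k) = lam * y * k + lam * x * k := by ring
      _ ≤ lam * y * (l * m ^ α - x) + lam * x * (l * (2 * m / Q) ^ α - -y) := add_le_add f1 f2
      _ = l * (y * (lam * m ^ α) + x * (lam * (2 * m / Q) ^ α)) := by ring
      _ = (x + y) * (l * kappa) := by
        rw [p1, p2]
        linear_combination (-l * y) * hkm - l * x * hkm2
end

section
/- Define two cost functions on ℝ²: c₁(z₁, z₂) = (1/8)·z₁² + (1 − z₁)²·z₂² + z₁²·(1 − z₂)² and c₂(z₁, z₂) = (1/8)·z₂² + (1 − z₁)²·z₂² + z₁²·(1 − z₂)², and the social cost SC(z₁, z₂) = c₁(z₁, z₂) + c₂(z₁, z₂). Then: (i) the point (3/4, 3/4) is a Nash equilibrium, i.e., for every t ∈ ℝ, c₁(3/4, 3/4) ≤ c₁(t, 3/4) and c₂(3/4, 3/4) ≤ c₂(3/4, t); (ii) SC(3/4, 3/4) > 0; and (iii) SC(0, 0) = 0, so the optimal social cost is 0 while the Nash equilibrium has positive social cost (the price of anarchy is unbounded). 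-/
/-- Cost of player 1: `c₁(z₁, z₂) = (1/8)·z₁² + (1 − z₁)²·z₂² + z₁²·(1 − z₂)²`. -/
noncomputable def c1 (z1 z2 : ℝ) : ℝ :=
  (1 / 8) * z1 ^ 2 + (1 - z1) ^ 2 * z2 ^ 2 + z1 ^ 2 * (1 - z2) ^ 2

/-- Cost of player 2: `c₂(z₁, z₂) = (1/8)·z₂² + (1 − z₁)²·z₂² + z₁²·(1 − z₂)²`. -/
noncomputable def c2 (z1 z2 : ℝ) : ℝ :=
  (1 / 8) * z2 ^ 2 + (1 - z1) ^ 2 * z2 ^ 2 + z1 ^ 2 * (1 - z2) ^ 2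

/-- Social cost. -/
noncomputable def SC (z1 z2 : ℝ) : ℝ := c1 z1 z2 + c2 z1 z2

/-- `(3/4, 3/4)` is a Nash equilibrium with positive social cost, while the
profile `(0, 0)` has social cost `0`; hence the price of anarchy is unbounded. -/
theorem stmt_16 :
    (∀ t : ℝ, c1 (3 / 4) (3 / 4) ≤ c1 t (3 / 4)) ∧
    (∀ t : ℝ, c2 (3 / 4) (3 / 4) ≤ c2 (3 / 4) t) ∧
    0 < SC (3 / 4) (3 / 4) ∧
    SC 0 0 = 0 := by
  refine ⟨fun t => ?_, fun t => ?_, ?_, ?_⟩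
  · unfold c1
    nlinarith [sq_nonneg (t - 3 / 4)]
  · unfold c2
    nlinarith [sq_nonneg (t - 3 / 4)]
  · norm_num [SC, c1, c2]
  · norm_num [SC, c1, c2]
end

section
/- Let n, m be positive integers. For each i, j ∈ {1, …, n} let W_{ij} be a symmetric positive semidefinite m × m real matrix with W_{ij} = W_{ji}, and for each i let R_i be a symmetric positive definite m × m real matrix. Let R be the nm × nm block-diagonal matrix with blocks R_1, …, R_n, and let L be the nm × nm block matrix with off-diagonal blocks L_{ij} = −W_{ij} for i ≠ j and diagonal blocks L_{ii} = Σ_{j ≠ i} W_{ij}. Then L is positive semidefinite and R + L is positive definite; consequently, for every s ∈ ℝ^{nm} the equation (R + L)·x = R·s has a unique solution x ∈ ℝ^{nm} (uniqueness of the Nash equilibrium of the undirected multidimensional quadratic opinion formation game). -/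
open Finset

namespace Matrix

variable {ι κ : Type*} [Fintype ι] [Fintype κ]

/-- The quadratic form of a block matrix is the sum of the forms of its blocks. -/
theorem dotProduct_mulVec_eq_sum_blocks (M : Matrix (ι × κ) (ι × κ) ℝ) (x : ι × κ → ℝ) :
    x ⬝ᵥ (M *ᵥ x) = ∑ i, ∑ j, (fun a => x (i, a)) ⬝ᵥ
      ((M.submatrix (fun a => (i, a)) (fun b => (j, b))) *ᵥ fun b => x (j, b)) := by
  simp only [dotProduct, mulVec, Fintype.sum_prod_type, submatrix_apply, Finset.mul_sum]
  exact Finset.sum_congr rfl fun i _ => Finset.sum_comm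

variable [DecidableEq ι]

/-- The block matrix with diagonal blocks `R i` and vanishing off-diagonal blocks. -/
def ofDiagonalBlocks (R : ι → Matrix κ κ ℝ) : Matrix (ι × κ) (ι × κ) ℝ :=
  fun p q => if p.1 = q.1 then R p.1 p.2 q.2 else 0

/-- The Laplacian of a graph with matrix weights `W i j`. -/
def blockLaplacian (W : ι → ι → Matrix κ κ ℝ) : Matrix (ι × κ) (ι × κ) ℝ :=
  fun p q =>
    if p.1 = q.1 then (∑ j ∈ Finset.univ.erase p.1, W p.1 j) p.2 q.2
    else -(W p.1 q.1 p.2 q.2)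

theorem dotProduct_ofDiagonalBlocks_mulVec (R : ι → Matrix κ κ ℝ) (x : ι × κ → ℝ) :
    x ⬝ᵥ (ofDiagonalBlocks R *ᵥ x) =
      ∑ i, (fun a => x (i, a)) ⬝ᵥ (R i *ᵥ fun a => x (i, a)) := by
  rw [dotProduct_mulVec_eq_sum_blocks]
  refine Finset.sum_congr rfl fun i _ => ?_
  rw [Finset.sum_eq_single i]
  · congr 2
    ext a b
    simp [ofDiagonalBlocks]
  · intro j _ hj
    have : (ofDiagonalBlocks R).submatrix (fun a => (i, a)) (fun b => (j, b)) = 0 := by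
      ext a b
      simp [ofDiagonalBlocks, hj.symm]
    simp [this]
  · simp

theorem PosDef.ofDiagonalBlocks {R : ι → Matrix κ κ ℝ} (hR : ∀ i, (R i).PosDef) :
    (ofDiagonalBlocks R).PosDef := by
  refine .of_dotProduct_mulVec_pos ?_ fun x hx => ?_
  · ext ⟨i, a⟩ ⟨j, b⟩
    by_cases h : i = j
    · subst h
      simpa [Matrix.ofDiagonalBlocks] using (hR i).isHermitian.apply a b
    · simp [Matrix.ofDiagonalBlocks, h, Ne.symm h]
  · rw [star_trivial, dotProduct_ofDiagonalBlocks_mulVec]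
    obtain ⟨⟨i, a⟩, hia⟩ := Function.ne_iff.mp hx
    refine Finset.sum_pos' (fun i _ => ?_) ⟨i, Finset.mem_univ i, ?_⟩
    · simpa using (hR i).posSemidef.dotProduct_mulVec_nonneg fun a => x (i, a)
    · have hxi : (fun a => x (i, a)) ≠ 0 := Function.ne_iff.mpr ⟨a, hia⟩
      simpa using (hR i).dotProduct_mulVec_pos hxi

theorem dotProduct_blockLaplacian_mulVec (W : ι → ι → Matrix κ κ ℝ) (x : ι × κ → ℝ) :
    x ⬝ᵥ (blockLaplacian W *ᵥ x) =
      ∑ i, ∑ j, (fun a => x (i, a)) ⬝ᵥ (W i j *ᵥ fun a => x (i, a) - x (j, a)) := by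
  rw [dotProduct_mulVec_eq_sum_blocks]
  refine Finset.sum_congr rfl fun i _ => ?_
  have hdiag : (blockLaplacian W).submatrix (fun a => (i, a)) (fun b => (i, b)) =
      ∑ j ∈ Finset.univ.erase i, W i j := by
    ext a b
    simp [blockLaplacian]
  have hoff : ∀ j ∈ Finset.univ.erase i,
      (blockLaplacian W).submatrix (fun a => (i, a)) (fun b => (j, b)) = -W i j := by
    intro j hj
    ext a b
    simp [blockLaplacian, (Finset.ne_of_mem_erase hj).symm]
  have hzero : (fun a => x (i, a) - x (i, a)) = 0 := by
    ext
    simp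
  rw [← Finset.add_sum_erase _ _ (Finset.mem_univ i),
    ← Finset.add_sum_erase _ (fun j => _ ⬝ᵥ (W i j *ᵥ fun a => x (i, a) - x (j, a)))
      (Finset.mem_univ i), hdiag, hzero, sum_mulVec, dotProduct_sum, mulVec_zero,
    dotProduct_zero, zero_add, ← Finset.sum_add_distrib]
  refine Finset.sum_congr rfl fun j hj => ?_
  rw [hoff j hj, ← dotProduct_add, neg_mulVec, ← sub_eq_add_neg, ← mulVec_sub]
  rfl

theorem two_mul_dotProduct_blockLaplacian_mulVec {W : ι → ι → Matrix κ κ ℝ}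
    (hW : ∀ i j, W i j = W j i) (x : ι × κ → ℝ) :
    2 * (x ⬝ᵥ (blockLaplacian W *ᵥ x)) =
      ∑ i, ∑ j, (fun a => x (i, a) - x (j, a)) ⬝ᵥ
        (W i j *ᵥ fun a => x (i, a) - x (j, a)) := by
  have hswap : x ⬝ᵥ (blockLaplacian W *ᵥ x) =
      ∑ i, ∑ j, (fun a => x (j, a)) ⬝ᵥ (W i j *ᵥ fun a => x (j, a) - x (i, a)) := by
    rw [dotProduct_blockLaplacian_mulVec, Finset.sum_comm]
    simp only [hW]
  rw [two_mul]
  nth_rw 1 [dotProduct_blockLaplacian_mulVec]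
  rw [hswap]
  simp only [← Finset.sum_add_distrib]
  refine Finset.sum_congr rfl fun i _ => Finset.sum_congr rfl fun j _ => ?_
  have hneg : (fun a => x (j, a) - x (i, a)) = -fun a => x (i, a) - x (j, a) := by
    ext
    simp
  rw [hneg, mulVec_neg, dotProduct_neg, ← sub_eq_add_neg, ← sub_dotProduct]
  rfl

theorem PosSemidef.blockLaplacian {W : ι → ι → Matrix κ κ ℝ}
    (hW : ∀ i j, (W i j).PosSemidef) (hsymm : ∀ i j, W i j = W j i) :
    (blockLaplacian W).PosSemidef := by
  refine .of_dotProduct_mulVec_nonneg ?_ fun x => ?_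
  · ext ⟨i, a⟩ ⟨j, b⟩
    by_cases h : i = j
    · subst h
      simpa [Matrix.blockLaplacian] using
        (posSemidef_sum (Finset.univ.erase i) fun j _ => hW i j).isHermitian.apply a b
    · simpa [Matrix.blockLaplacian, h, Ne.symm h, hsymm j i] using (hW i j).isHermitian.apply a b
  · have hsum : 0 ≤ 2 * (x ⬝ᵥ (Matrix.blockLaplacian W *ᵥ x)) := by
      rw [two_mul_dotProduct_blockLaplacian_mulVec hsymm]
      refine Finset.sum_nonneg fun i _ => Finset.sum_nonneg fun j _ => ?_
      simpa using (hW i j).dotProduct_mulVec_nonneg fun a => x (i, a) - x (j, a)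
    rw [star_trivial]
    linarith

theorem PosDef.existsUnique_mulVec_eq {A : Matrix ι ι ℝ} (hA : A.PosDef) (b : ι → ℝ) :
    ∃! x, A *ᵥ x = b :=
  Function.Bijective.existsUnique
    ⟨mulVec_injective_iff_isUnit.mpr hA.isUnit, mulVec_surjective_iff_isUnit.mpr hA.isUnit⟩ b

end Matrix

/-- for symmetric PSD weight blocks `W_{ij} = W_{ji}` and symmetric positive
definite `R_i`, the block matrix `L` (with `L_{ij} = −W_{ij}` off the diagonal and
`L_{ii} = Σ_{j ≠ i} W_{ij}`) is positive semidefinite, `R + L` is positive definite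
(where `R` is block-diagonal with blocks `R_i`), and hence for every `s` the equation
`(R + L)x = Rs` has a unique solution: the Nash equilibrium is unique. -/
theorem stmt_17 {n m : ℕ} (hn : 0 < n) (hm : 0 < m)
    (W : Fin n → Fin n → Matrix (Fin m) (Fin m) ℝ)
    (hWpsd : ∀ i j, (W i j).PosSemidef) (hWsymm : ∀ i j, W i j = W j i)
    (R : Fin n → Matrix (Fin m) (Fin m) ℝ) (hRpd : ∀ i, (R i).PosDef) :
    let Rbig : Matrix (Fin n × Fin m) (Fin n × Fin m) ℝ :=
      fun p q => if p.1 = q.1 then R p.1 p.2 q.2 else 0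
    let L : Matrix (Fin n × Fin m) (Fin n × Fin m) ℝ :=
      fun p q =>
        if p.1 = q.1 then (∑ j ∈ Finset.univ.erase p.1, W p.1 j) p.2 q.2
        else -(W p.1 q.1 p.2 q.2)
    L.PosSemidef ∧ (Rbig + L).PosDef ∧
      ∀ s : Fin n × Fin m → ℝ, ∃! x : Fin n × Fin m → ℝ,
        (Rbig + L).mulVec x = Rbig.mulVec s := by
  intro Rbig L
  have hL : L.PosSemidef := .blockLaplacian hWpsd hWsymm
  have hRL : (Rbig + L).PosDef := (Matrix.PosDef.ofDiagonalBlocks hRpd).add_posSemidef hL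
  exact ⟨hL, hRL, fun s => hRL.existsUnique_mulVec_eq _⟩
end

section
/- Let n, m be positive integers and for each i, j ∈ {1, …, n} let W_{ij} be a symmetric positive semidefinite m × m real matrix with W_{ij} = W_{ji}, such that Σ_{j=1}^n W_{ij} = I_m for every i (the weight-normalized condition). Let W be the nm × nm block matrix with blocks W_{ij}. Then both I + W and I − W are positive semidefinite; consequently every eigenvalue μ of the symmetric matrix W satisfies |μ| ≤ 1, i.e., the spectral norm of W is at most 1. -/
namespace Matrix

variable {ι κ : Type*} [Fintype ι] [Fintype κ]

/-- The quadratic form of a block matrix, computed blockwise. -/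
theorem dotProduct_comp_mulVec (W : Matrix ι ι (Matrix κ κ ℝ)) (x : ι × κ → ℝ) :
    x ⬝ᵥ (comp ι ι κ κ ℝ W *ᵥ x) =
      ∑ i, ∑ j, (fun a => x (i, a)) ⬝ᵥ (W i j *ᵥ fun a => x (j, a)) := by
  simp only [dotProduct, mulVec, Fintype.sum_prod_type, comp_apply, Finset.mul_sum]
  exact Finset.sum_congr rfl fun i _ => Finset.sum_comm

theorem dotProduct_self_eq_sum_blocks [DecidableEq κ] {W : Matrix ι ι (Matrix κ κ ℝ)}
    (hnorm : ∀ i, ∑ j, W i j = 1) (x : ι × κ → ℝ) :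
    x ⬝ᵥ x = ∑ i, ∑ j, (fun a => x (i, a)) ⬝ᵥ (W i j *ᵥ fun a => x (i, a)) := by
  simp only [← dotProduct_sum, ← sum_mulVec, hnorm, one_mulVec]
  simp only [dotProduct, Fintype.sum_prod_type]

/-- For weight-normalized positive semidefinite blocks and a sign `s`, the quadratic form of
`1 + s • W` is half the sum of the forms `W i j` at `x i + s • x j`, hence nonnegative. -/
theorem posSemidef_one_add_smul_comp [DecidableEq ι] [DecidableEq κ]
    {W : Matrix ι ι (Matrix κ κ ℝ)} (hpsd : ∀ i j, (W i j).PosSemidef)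
    (hsymm : ∀ i j, W i j = W j i) (hnorm : ∀ i, ∑ j, W i j = 1) {s : ℝ} (hs : s * s = 1) :
    (1 + s • comp ι ι κ κ ℝ W).PosSemidef := by
  refine .of_dotProduct_mulVec_nonneg ?_ fun x => ?_
  · have h : (comp ι ι κ κ ℝ W).IsHermitian := by
      ext p q
      simpa [hsymm q.1 p.1] using (hpsd p.1 q.1).isHermitian.apply p.2 q.2
    exact isHermitian_one.add (h.smul (IsSelfAdjoint.all s))
  · have hself := dotProduct_self_eq_sum_blocks hnorm x
    have hself' : x ⬝ᵥ x = ∑ i, ∑ j, (fun a => x (j, a)) ⬝ᵥ (W i j *ᵥ fun a => x (j, a)) := by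
      rw [hself, Finset.sum_comm]
      exact Finset.sum_congr rfl fun i _ => Finset.sum_congr rfl fun j _ => by rw [hsymm]
    have hcomp := dotProduct_comp_mulVec W x
    have hcomp' : x ⬝ᵥ (comp ι ι κ κ ℝ W *ᵥ x) =
        ∑ i, ∑ j, (fun a => x (j, a)) ⬝ᵥ (W i j *ᵥ fun a => x (i, a)) := by
      rw [hcomp, Finset.sum_comm]
      exact Finset.sum_congr rfl fun i _ => Finset.sum_congr rfl fun j _ => by rw [hsymm]
    have hnonneg : 0 ≤ ∑ i, ∑ j, ((fun a => x (i, a)) + s • fun a => x (j, a)) ⬝ᵥ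
        (W i j *ᵥ ((fun a => x (i, a)) + s • fun a => x (j, a))) :=
      Finset.sum_nonneg fun i _ => Finset.sum_nonneg fun j _ => 
        (hpsd i j).dotProduct_mulVec_nonneg _
    simp only [mulVec_add, mulVec_smul, add_dotProduct, dotProduct_add, smul_dotProduct,
      dotProduct_smul, smul_eq_mul, Finset.sum_add_distrib, ← Finset.mul_sum, ← hself, ← hself',
      ← hcomp, ← hcomp'] at hnonneg
    simp only [star_trivial, add_mulVec, one_mulVec, smul_mulVec, dotProduct_add,
      dotProduct_smul, smul_eq_mul]
    linear_combination (1 / 2) * hnonneg + (x ⬝ᵥ x / 2) * hs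

/-- Real eigenvalues of `A` lie in `[-1, 1]` when `1 + A` and `1 - A` are positive semidefinite. -/
theorem abs_le_one_of_mulVec_eq_smul [DecidableEq ι] {A : Matrix ι ι ℝ}
    (hadd : (1 + A).PosSemidef) (hsub : (1 - A).PosSemidef) {μ : ℝ} {v : ι → ℝ} (hv : v ≠ 0)
    (h : A *ᵥ v = μ • v) : |μ| ≤ 1 := by
  have hpos : 0 < v ⬝ᵥ v := by simpa using dotProduct_star_self_pos_iff.mpr hv
  have h₁ := hadd.dotProduct_mulVec_nonneg v
  have h₂ := hsub.dotProduct_mulVec_nonneg v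
  simp only [star_trivial, add_mulVec, sub_mulVec, one_mulVec, h, dotProduct_add, dotProduct_sub,
    dotProduct_smul, smul_eq_mul] at h₁ h₂
  rw [abs_le]
  constructor <;> nlinarith

end Matrix


/-- for symmetric PSD weight blocks `W_{ij} = W_{ji}` satisfying the
weight-normalized condition `Σ_j W_{ij} = I_m`, the block matrix `W` satisfies:
`I + W` and `I − W` are positive semidefinite, and consequently every eigenvalue `μ`
of the symmetric matrix `W` satisfies `|μ| ≤ 1`. -/
theorem stmt_18 {n m : ℕ} (hn : 0 < n) (hm : 0 < m)
    (W : Fin n → Fin n → Matrix (Fin m) (Fin m) ℝ)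
    (hWpsd : ∀ i j, (W i j).PosSemidef) (hWsymm : ∀ i j, W i j = W j i)
    (hnorm : ∀ i, ∑ j : Fin n, W i j = 1) :
    let Wbig : Matrix (Fin n × Fin m) (Fin n × Fin m) ℝ := fun p q => W p.1 q.1 p.2 q.2
    (1 + Wbig).PosSemidef ∧ (1 - Wbig).PosSemidef ∧
      ∀ (μ : ℝ) (v : Fin n × Fin m → ℝ), v ≠ 0 → Wbig.mulVec v = μ • v → |μ| ≤ 1 := by
  intro Wbig
  have hsign {s : ℝ} (hs : s * s = 1) : (1 + s • Wbig).PosSemidef :=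
    Matrix.posSemidef_one_add_smul_comp hWpsd hWsymm hnorm hs
  have hadd : (1 + Wbig).PosSemidef := by
    simpa only [one_smul] using hsign (one_mul 1)
  have hsub : (1 - Wbig).PosSemidef := by
    simpa only [neg_smul, one_smul, ← sub_eq_add_neg] using hsign (s := -1) (by norm_num)
  exact ⟨hadd, hsub, fun μ v hv h => Matrix.abs_le_one_of_mulVec_eq_smul hadd hsub hv h⟩
end
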